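/- Let L_k : ℝⁿ×ℝⁿ → [0,∞) be continuous functions converging pointwise and nondecreasingly to L, each L_k convex in the second variable, L_k ≥ Θ for a fixed convex superlinear Θ, and let V_k, V denote the value functions of the Bolza problems with Lagrangians L_k and L respectively (same terminal cost φ ≥ 0 lsc). Then V_k converges pointwise to V on [0,∞) × ℝⁿ. -/

import Mathlib

open MeasureTheory Set Filter
open scoped ENNReal

def Superlinear {n : ℕ} (Θ : EuclideanSpace ℝ (Fin n) → ℝ) : Prop :=
  ∀ M : ℝ, ∃ R : ℝ, ∀ u : EuclideanSpace ℝ (Fin n), R ≤ ‖u‖ → M * ‖u‖ ≤ Θ u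

/-- The value function of the Bolza problem: infimum of total cost over
absolutely continuous arcs starting at `x` (represented by their integrable
derivative `y'`). -/
noncomputable def bolzaValue {n : ℕ}
    (L : EuclideanSpace ℝ (Fin n) → EuclideanSpace ℝ (Fin n) → ℝ)
    (φ : EuclideanSpace ℝ (Fin n) → ℝ≥0∞)
    (t : ℝ) (x : EuclideanSpace ℝ (Fin n)) : ℝ≥0∞ :=
  ⨅ (y : ℝ → EuclideanSpace ℝ (Fin n)) (y' : ℝ → EuclideanSpace ℝ (Fin n))
    (_ : IntervalIntegrable y' volume 0 t)
    (_ : ∀ s ∈ Set.Icc (0:ℝ) t, y s = x + ∫ τ in (0:ℝ)..s, y' τ)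
    (_ : IntervalIntegrable (fun s => L (y s) (y' s)) volume 0 t),
    ENNReal.ofReal (∫ s in (0:ℝ)..t, L (y s) (y' s)) + φ (y t)

open scoped Topology

/-- A convex lower semicontinuous limit of increasing, uniformly superlinear Lagrangians has, up to
`ε`, affine minorants that are locally uniform in the state and eventually uniform in the index. -/
theorem exists_affine_minorant_eventually {E : Type*} [NormedAddCommGroup E] [NormedSpace ℝ E]
    [ProperSpace E] {L : E → E → ℝ} {Lk : ℕ → E → E → ℝ}
    (hLlsc : LowerSemicontinuous (fun p : E × E => L p.1 p.2))
    (hLconv : ∀ x, ConvexOn ℝ univ (L x))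
    (hLklsc : ∀ k, LowerSemicontinuous (fun p : E × E => Lk k p.1 p.2))
    {Θ : E → ℝ} (hΘ : ∀ M : ℝ, ∃ R : ℝ, ∀ u, R ≤ ‖u‖ → M * ‖u‖ ≤ Θ u)
    (hcoer : ∀ k x u, Θ u ≤ Lk k x u)
    (hmono : ∀ x u, Monotone fun k => Lk k x u)
    (hlim : ∀ x u, Tendsto (fun k => Lk k x u) atTop (𝓝 (L x u)))
    (x v : E) {ε : ℝ} (hε : 0 < ε) :
    ∃ l : E →L[ℝ] ℝ, ∀ᶠ p : ℕ × E in atTop ×ˢ 𝓝 x, ∀ u,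
      L x v + l (u - v) - ε ≤ Lk p.1 p.2 u := by
  have hlsc : LowerSemicontinuous (L x) := hLlsc.comp (g := fun u => (x, u)) (by fun_prop)
  obtain ⟨l, c, hle, heq⟩ := (hLconv x).exists_affine_le_of_lt (𝕜 := ℝ) (x := v)
    (a := L x v - ε / 2) (mem_univ v) (by linarith) isClosed_univ (hlsc.lowerSemicontinuousOn _)
  replace hle : ∀ u, l u + c ≤ L x u := fun u => by simpa using hle ⟨u, mem_univ u⟩
  replace heq : l v + c = L x v - ε / 2 := by simpa using heq
  obtain ⟨R, hR⟩ := hΘ (‖l‖ + 1)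
  refine ⟨l, ?_⟩
  have hbig : ∀ u, max R |c| ≤ ‖u‖ → l u + c ≤ Θ u := by
    intro u hu
    have h1 := hR u ((le_max_left _ _).trans hu)
    have h2 := (le_abs_self c).trans ((le_max_right _ _).trans hu)
    have h3 := (le_abs_self (l u)).trans (l.le_opNorm u)
    linarith
  have hcpt : ∀ᶠ q : (ℕ × E) × E in (atTop ×ˢ 𝓝 x) ×ˢ 𝓝ˢ (Metric.closedBall 0 (max R |c|)),
      l q.2 + c - ε / 2 < Lk q.1.1 q.1.2 q.2 := by
    refine (isCompact_closedBall _ _).mem_prod_nhdsSet_of_forall fun u _ => ?_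
    obtain ⟨k, hk⟩ := ((hlim x u).eventually_const_lt
      (show l u + c - ε / 2 < L x u by linarith [hle u])).exists
    have hgap : LowerSemicontinuous fun p : E × E => Lk k p.1 p.2 + -l p.2 :=
      (hLklsc k).add (Continuous.lowerSemicontinuous (by fun_prop))
    have hnear : ∀ᶠ p : E × E in 𝓝 x ×ˢ 𝓝 u, c - ε / 2 < Lk k p.1 p.2 + -l p.2 := by
      rw [← nhds_prod_eq]
      exact hgap (x, u) _ (by dsimp only; linarith)
    have hall := (eventually_ge_atTop k).prod_mk hnear
    filter_upwards [tendsto_prodAssoc.eventually hall] with q ⟨hkq, hq⟩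
    have := hmono q.1.2 q.2 hkq
    simp only [Equiv.prodAssoc_apply] at hq this
    linarith
  filter_upwards [hcpt.curry] with p hp u
  rw [map_sub]
  rcases le_total (max R |c|) ‖u‖ with hu | hu
  · linarith [hbig u hu, hcoer p.1 p.2 u]
  · have := hp.self_of_nhdsSet u (by simpa using hu)
    linarith

/-- `y` is an absolutely continuous arc on `[0, t]` issued from `x`, with derivative `y'`. -/
structure IsArc {E : Type*} [NormedAddCommGroup E] [NormedSpace ℝ E] (x : E) (t : ℝ)
    (y y' : ℝ → E) : Prop where
  intervalIntegrable : IntervalIntegrable y' volume 0 t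
  eq_add_integral : ∀ s ∈ Icc (0 : ℝ) t, y s = x + ∫ τ in (0 : ℝ)..s, y' τ

theorem IntervalIntegrable.mono_mem_Icc {F : Type*} [NormedAddCommGroup F] {f : ℝ → F}
    {a b t : ℝ} (hf : IntervalIntegrable f volume 0 t) (ha : a ∈ Icc 0 t) (hb : b ∈ Icc 0 t) :
    IntervalIntegrable f volume a b :=
  hf.mono_set (uIcc_subset_uIcc (by rwa [uIcc_of_le (ha.1.trans ha.2)])
    (by rwa [uIcc_of_le (ha.1.trans ha.2)]))

namespace IsArc

variable {E : Type*} [NormedAddCommGroup E] [NormedSpace ℝ E] {x : E} {t : ℝ} {y y' : ℝ → E}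

theorem sub_eq_integral (h : IsArc x t y y') {a b : ℝ} (ha : a ∈ Icc 0 t) (hb : b ∈ Icc 0 t) :
    y b - y a = ∫ τ in a..b, y' τ := by
  have h0 : (0 : ℝ) ∈ Icc 0 t := ⟨le_rfl, ha.1.trans ha.2⟩
  rw [h.eq_add_integral b hb, h.eq_add_integral a ha, add_sub_add_left_eq_sub,
    intervalIntegral.integral_interval_sub_left (h.intervalIntegrable.mono_mem_Icc h0 hb)
      (h.intervalIntegrable.mono_mem_Icc h0 ha)]

theorem continuousOn (h : IsArc x t y y') (ht : 0 ≤ t) : ContinuousOn y (Icc 0 t) := by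
  have hc := intervalIntegral.continuousOn_primitive_interval' h.intervalIntegrable left_mem_uIcc
  rw [uIcc_of_le ht] at hc
  exact (continuousOn_const.add hc).congr h.eq_add_integral

theorem dist_le (h : IsArc x t y y') {ℓ : ℝ → ℝ} (hℓ : IntervalIntegrable ℓ volume 0 t)
    {R M : ℝ} (hbd : ∀ s ∈ Icc 0 t, ‖y' s‖ ≤ R + ℓ s / M) {a b : ℝ}
    (ha : a ∈ Icc 0 t) (hb : b ∈ Icc 0 t) :
    dist (y a) (y b) ≤ R * dist a b + (∫ s in uIoc a b, ℓ s) / M := by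
  have hℓ' := (hℓ.mono_mem_Icc ha hb).def'
  have hR : IntegrableOn (fun _ => R) (uIoc a b) := integrableOn_const (by simp [uIoc])
  have hsub : uIoc a b ⊆ Icc 0 t := uIoc_subset_uIcc.trans (uIcc_subset_Icc ha hb)
  rw [dist_comm, dist_eq_norm, h.sub_eq_integral ha hb]
  calc ‖∫ τ in a..b, y' τ‖ ≤ ∫ τ in uIoc a b, ‖y' τ‖ :=
        intervalIntegral.norm_integral_le_integral_norm_uIoc
    _ ≤ ∫ τ in uIoc a b, (R + ℓ τ / M) :=
        setIntegral_mono_on (h.intervalIntegrable.mono_mem_Icc ha hb).def'.norm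
          (hR.add (hℓ'.div_const M)) measurableSet_uIoc
          fun s hs => hbd s (hsub hs)
    _ = R * dist a b + (∫ s in uIoc a b, ℓ s) / M := by
        rw [integral_add hR (hℓ'.div_const M), integral_div]
        simp [Real.dist_eq, uIoc, max_sub_min_eq_abs', Measure.real, mul_comm]

theorem sum_dist_le (h : IsArc x t y y') (ht : 0 ≤ t) {ℓ : ℝ → ℝ}
    (hℓ : IntervalIntegrable ℓ volume 0 t) (hℓ0 : ∀ s ∈ Icc 0 t, 0 ≤ ℓ s)
    {R M : ℝ} (hM : 0 < M) (hbd : ∀ s ∈ Icc 0 t, ‖y' s‖ ≤ R + ℓ s / M)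
    {I : ℕ × (ℕ → ℝ × ℝ)} (hI : I ∈ AbsolutelyContinuousOnInterval.disjWithin 0 t) :
    ∑ i ∈ Finset.range I.1, dist (y (I.2 i).1) (y (I.2 i).2) ≤
      R * (∑ i ∈ Finset.range I.1, dist (I.2 i).1 (I.2 i).2) + (∫ s in (0 : ℝ)..t, ℓ s) / M := by
  obtain ⟨hmem, hdisj⟩ := hI
  rw [uIcc_of_le ht] at hmem
  have hsub : ∀ i ∈ Finset.range I.1, uIoc (I.2 i).1 (I.2 i).2 ⊆ Ioc 0 t := fun i hi => by
    exact Ioc_subset_Ioc (le_min (hmem i hi).1.1 (hmem i hi).2.1)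
      (max_le (hmem i hi).1.2 (hmem i hi).2.2)
  have hℓ' : IntegrableOn ℓ (Ioc 0 t) := (intervalIntegrable_iff_integrableOn_Ioc_of_le ht).1 hℓ
  calc ∑ i ∈ Finset.range I.1, dist (y (I.2 i).1) (y (I.2 i).2)
      ≤ ∑ i ∈ Finset.range I.1, (R * dist (I.2 i).1 (I.2 i).2
          + (∫ s in uIoc (I.2 i).1 (I.2 i).2, ℓ s) / M) :=
        Finset.sum_le_sum fun i hi => h.dist_le hℓ hbd (hmem i hi).1 (hmem i hi).2
    _ = R * (∑ i ∈ Finset.range I.1, dist (I.2 i).1 (I.2 i).2) +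
          (∫ s in ⋃ i ∈ Finset.range I.1, uIoc (I.2 i).1 (I.2 i).2, ℓ s) / M := by
        rw [Finset.sum_add_distrib, Finset.mul_sum, ← Finset.sum_div,
          integral_biUnion_finset _ (fun _ _ => measurableSet_uIoc) hdisj
            (fun i hi => hℓ'.mono_set (hsub i hi))]
    _ ≤ _ := by
        gcongr
        rw [intervalIntegral.integral_of_le ht]
        refine setIntegral_mono_set hℓ' ?_ (iUnion₂_subset hsub).eventuallyLE
        exact (ae_restrict_mem measurableSet_Ioc).mono fun s hs => hℓ0 s (Ioc_subset_Icc_self hs)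

end IsArc

/-- The fundamental theorem of calculus for absolutely continuous arcs in Euclidean space. -/
theorem AbsolutelyContinuousOnInterval.exists_isArc {n : ℕ} {t : ℝ} (ht : 0 ≤ t)
    {y : ℝ → EuclideanSpace ℝ (Fin n)} (hy : AbsolutelyContinuousOnInterval y 0 t) :
    ∃ y', IsArc (y 0) t y y' ∧ ∀ᵐ s, s ∈ Icc 0 t → HasDerivAt y (y' s) s := by
  have hcomp : ∀ i, AbsolutelyContinuousOnInterval (fun s => y s i) 0 t := by
    intro i
    rw [absolutelyContinuousOnInterval_iff] at hy ⊢
    refine fun ε hε => (hy ε hε).imp fun δ hδ => ⟨hδ.1, fun I hI hlt => lt_of_le_of_lt ?_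
      (hδ.2 I hI hlt)⟩
    refine Finset.sum_le_sum fun j _ => ?_
    rw [dist_eq_norm, dist_eq_norm]
    exact PiLp.norm_apply_le (y (I.2 j).1 - y (I.2 j).2) i
  set y' : ℝ → EuclideanSpace ℝ (Fin n) := fun s => WithLp.toLp 2 fun i => deriv (fun r => y r i) s
  have hint : IntervalIntegrable y' volume 0 t := by
    rw [intervalIntegrable_iff]
    refine Integrable.of_eval_piLp fun i => ?_
    exact (hcomp i).intervalIntegrable_deriv.def'
  refine ⟨y', ⟨hint, fun s hs => ?_⟩, ?_⟩
  · ext i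
    have hle : IntervalIntegrable y' volume 0 s := hint.mono_mem_Icc ⟨le_rfl, ht⟩ hs
    have hi := ((hcomp i).mono (c := 0) (d := s) (by
      rw [uIcc_of_le ht, uIcc_of_le hs.1]; exact Icc_subset_Icc_right hs.2)).integral_deriv_eq_sub
    have hp := (EuclideanSpace.proj i : EuclideanSpace ℝ (Fin n) →L[ℝ] ℝ).intervalIntegral_comp_comm
      hle
    have hp' : (∫ τ in (0 : ℝ)..s, y' τ) i = y s i - y 0 i := hp.symm.trans hi
    rw [PiLp.add_apply, hp', add_sub_cancel]
  · have hall : ∀ᵐ s, ∀ i, s ∈ uIcc 0 t → DifferentiableAt ℝ (fun r => y r i) s :=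
      ae_all_iff.2 fun i => (hcomp i).ae_differentiableAt
    filter_upwards [hall] with s hs hmem
    rw [← uIcc_of_le ht] at hmem
    have hd : DifferentiableAt ℝ y s := differentiableAt_euclidean.2 fun i => hs i hmem
    have hy' : y' s = deriv y s := PiLp.ext fun i =>
      ((EuclideanSpace.proj i : EuclideanSpace ℝ (Fin n) →L[ℝ] ℝ).hasFDerivAt.comp_hasDerivAt s
        hd.hasDerivAt).deriv
    exact hy' ▸ hd.hasDerivAt

theorem IsArc.le_hasDerivAt_cost_of_tendsto {E : Type*} [NormedAddCommGroup E] [NormedSpace ℝ E]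
    [CompleteSpace E] {Lk : ℕ → E → E → ℝ} {x : E} {t : ℝ} {y y' : ℕ → ℝ → E}
    (harc : ∀ k, IsArc x t (y k) (y' k))
    (hℓ : ∀ k, IntervalIntegrable (fun s => Lk k (y k s) (y' k s)) volume 0 t)
    (hequi : ∀ ε > 0, ∃ δ > 0, ∀ k, ∀ a ∈ Icc 0 t, ∀ b ∈ Icc 0 t, dist a b < δ →
      dist (y k a) (y k b) < ε)
    {f : Filter ℕ} [f.NeBot] {Y : ℝ → E} {A : ℝ → ℝ}
    (hY : ∀ s ∈ Icc 0 t, Tendsto (fun k => y k s) f (𝓝 (Y s)))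
    (hA : ∀ s ∈ Icc 0 t,
      Tendsto (fun k => ∫ r in (0 : ℝ)..s, Lk k (y k r) (y' k r)) f (𝓝 (A s)))
    {s : ℝ} (hs : s ∈ Ioo 0 t) {v : E} {α c : ℝ} (hYv : HasDerivAt Y v s)
    (hAα : HasDerivAt A α s)
    (hminor : ∀ ε > 0, ∃ l : E →L[ℝ] ℝ, ∀ᶠ p : ℕ × E in f ×ˢ 𝓝 (Y s), ∀ u,
      c + l (u - v) - ε ≤ Lk p.1 p.2 u) :
    c ≤ α := by
  refine le_of_forall_pos_le_add fun ε hε => ?_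
  obtain ⟨l, hl⟩ := hminor ε hε
  obtain ⟨pa, hpa, pb, hpb, hl⟩ := Filter.eventually_prod_iff.1 hl
  obtain ⟨η, hη, hpb⟩ := Metric.eventually_nhds_iff.1 hpb
  obtain ⟨δ, hδ, hequi⟩ := hequi (η / 2) (half_pos hη)
  have hsI : s ∈ Icc 0 t := Ioo_subset_Icc_self hs
  have hincr : ∀ᶠ h in 𝓝[>] (0 : ℝ),
      c - ε + l (h⁻¹ • (Y (s + h) - Y s) - v) ≤ h⁻¹ • (A (s + h) - A s) := by
    have hsmall : Iio (min δ (t - s)) ∈ 𝓝[>] (0 : ℝ) :=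
      mem_nhdsWithin_of_mem_nhds (Iio_mem_nhds (lt_min hδ (by linarith [hs.2])))
    filter_upwards [self_mem_nhdsWithin, hsmall] with h (hh : 0 < h) hh'
    have hhδ : h < δ := hh'.trans_le (min_le_left _ _)
    have hht : h < t - s := hh'.trans_le (min_le_right _ _)
    have hshI : s + h ∈ Icc 0 t := ⟨by linarith [hs.1], by linarith⟩
    have hk : ∀ᶠ k in f, h * (c - ε) + l (y k (s + h) - y k s - h • v) ≤
        (∫ r in (0 : ℝ)..(s + h), Lk k (y k r) (y' k r)) -
          ∫ r in (0 : ℝ)..s, Lk k (y k r) (y' k r) := by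
      filter_upwards [hpa, Metric.tendsto_nhds.1 (hY s hsI) (η / 2) (half_pos hη)] with k hka hks
      have h0 : (0 : ℝ) ∈ Icc 0 t := ⟨le_rfl, hs.1.le.trans hs.2.le⟩
      have hy' := (harc k).intervalIntegrable.mono_mem_Icc hsI hshI
      have hly' : IntervalIntegrable (fun r => l (y' k r)) volume s (s + h) :=
        ⟨l.integrable_comp hy'.1, l.integrable_comp hy'.2⟩
      rw [intervalIntegral.integral_interval_sub_left ((hℓ k).mono_mem_Icc h0 hshI)
        ((hℓ k).mono_mem_Icc h0 hsI), (harc k).sub_eq_integral hsI hshI, map_sub,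
        ← l.intervalIntegral_comp_comm hy']
      calc h * (c - ε) + ((∫ r in s..(s + h), l (y' k r)) - l (h • v))
          = ∫ r in s..(s + h), (l (y' k r) + (c - ε - l v)) := by
            rw [intervalIntegral.integral_add hly' (by simp)]
            simp
            ring
        _ ≤ _ := by
            refine intervalIntegral.integral_mono_on (by linarith) (hly'.add (by simp))
              ((hℓ k).mono_mem_Icc hsI hshI) fun r hr => ?_
            have hrI : r ∈ Icc 0 t := ⟨hsI.1.trans hr.1, hr.2.trans hshI.2⟩
            have hd : dist r s < δ := by
              rw [Real.dist_eq, abs_of_nonneg (by linarith [hr.1])]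
              linarith [hr.2]
            have := hl hka (hpb ((dist_triangle _ (y k s) _).trans_lt
              (by linarith [hequi k r hrI s hsI hd] : _ < η))) (y' k r)
            rw [map_sub] at this
            dsimp only at this
            linarith
    have hlim := le_of_tendsto_of_tendsto
      (((l.continuous.tendsto _).comp
        ((((hY _ hshI).sub (hY s hsI)).sub_const (h • v)))).const_add (h * (c - ε)))
      ((hA _ hshI).sub (hA s hsI)) hk
    have hmul := mul_le_mul_of_nonneg_left hlim (inv_pos.2 hh).le
    rw [smul_eq_mul]
    refine le_of_eq_of_le ?_ hmul
    have hv : h⁻¹ • (Y (s + h) - Y s) - v = h⁻¹ • (Y (s + h) - Y s - h • v) := by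
      rw [smul_sub _ _ (h • v), inv_smul_smul₀ hh.ne']
    rw [hv, map_smul, smul_eq_mul, mul_add, inv_mul_cancel_left₀ hh.ne']
  have hlim : c - ε + l (v - v) ≤ α :=
    le_of_tendsto_of_tendsto
      (((l.continuous.tendsto _).comp (hYv.tendsto_slope_zero_right.sub_const v)).const_add (c - ε))
      hAα.tendsto_slope_zero_right hincr
  rw [sub_self, map_zero] at hlim
  linarith

/-- Compactness of arcs with bounded cost, together with lower semicontinuity of the cost: along a
given ultrafilter, such arcs converge to an arc whose limiting cost is at most the limit cost. -/
theorem exists_isArc_cost_le_of_ultrafilter {n : ℕ}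
    {L : EuclideanSpace ℝ (Fin n) → EuclideanSpace ℝ (Fin n) → ℝ}
    {Lk : ℕ → EuclideanSpace ℝ (Fin n) → EuclideanSpace ℝ (Fin n) → ℝ}
    (hL0 : ∀ x u, 0 ≤ L x u)
    (hLlsc : LowerSemicontinuous
      (fun p : EuclideanSpace ℝ (Fin n) × EuclideanSpace ℝ (Fin n) => L p.1 p.2))
    (hLconv : ∀ x, ConvexOn ℝ univ (L x))
    (hLklsc : ∀ k, LowerSemicontinuous
      (fun p : EuclideanSpace ℝ (Fin n) × EuclideanSpace ℝ (Fin n) => Lk k p.1 p.2))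
    {Θ : EuclideanSpace ℝ (Fin n) → ℝ} (hΘ0 : ∀ u, 0 ≤ Θ u) (hΘ : Superlinear Θ)
    (hcoer : ∀ k x u, Θ u ≤ Lk k x u)
    (hmono : ∀ x u, Monotone fun k => Lk k x u)
    (hlim : ∀ x u, Tendsto (fun k => Lk k x u) atTop (𝓝 (L x u)))
    {t : ℝ} (ht : 0 ≤ t) {x : EuclideanSpace ℝ (Fin n)} {C : ℝ}
    {y y' : ℕ → ℝ → EuclideanSpace ℝ (Fin n)}
    (harc : ∀ k, IsArc x t (y k) (y' k))
    (hℓ : ∀ k, IntervalIntegrable (fun s => Lk k (y k s) (y' k s)) volume 0 t)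
    (hC : ∀ k, ∫ s in (0 : ℝ)..t, Lk k (y k s) (y' k s) ≤ C)
    (f : Ultrafilter ℕ) (hf : (f : Filter ℕ) ≤ atTop) :
    ∃ Y Y', IsArc x t Y Y' ∧ IntervalIntegrable (fun s => L (Y s) (Y' s)) volume 0 t ∧
      Tendsto (fun k => y k t) f (𝓝 (Y t)) ∧
      ∃ a, Tendsto (fun k => ∫ s in (0 : ℝ)..t, Lk k (y k s) (y' k s)) f (𝓝 a) ∧
        ∫ s in (0 : ℝ)..t, L (Y s) (Y' s) ≤ a := by
  have h0 : (0 : ℝ) ∈ Icc 0 t := left_mem_Icc.2 ht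
  have htI : t ∈ Icc 0 t := right_mem_Icc.2 ht
  have hLk0 : ∀ k x u, 0 ≤ Lk k x u := fun k x u => (hΘ0 u).trans (hcoer k x u)
  have hbd : ∀ M > 0, ∃ R > 0, ∀ k x u, ‖u‖ ≤ R + Lk k x u / M := by
    intro M hM
    obtain ⟨R, hR⟩ := hΘ M
    refine ⟨max R 1, by positivity, fun k x u => ?_⟩
    have hdiv : 0 ≤ Lk k x u / M := div_nonneg (hLk0 k x u) hM.le
    rcases le_total R ‖u‖ with hu | hu
    · have : ‖u‖ ≤ Lk k x u / M := by
        rw [le_div_iff₀' hM]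
        exact (hR u hu).trans (hcoer k x u)
      linarith [le_max_right R 1]
    · linarith [le_max_left R 1]
  have hsum : ∀ M > 0, ∃ R > 0, ∀ k, ∀ I ∈ AbsolutelyContinuousOnInterval.disjWithin 0 t,
      ∑ i ∈ Finset.range I.1, dist (y k (I.2 i).1) (y k (I.2 i).2) ≤
        R * (∑ i ∈ Finset.range I.1, dist (I.2 i).1 (I.2 i).2) + C / M := by
    intro M hM
    obtain ⟨R, hR, hbd⟩ := hbd M hM
    refine ⟨R, hR, fun k I hI => ((harc k).sum_dist_le ht (hℓ k) (fun s _ => hLk0 k _ _) hM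
      (fun s _ => hbd k (y k s) (y' k s)) hI).trans ?_⟩
    gcongr
    exact hC k
  have hC0 : 0 ≤ C :=
    (intervalIntegral.integral_nonneg ht fun s _ => hLk0 0 _ _).trans (hC 0)
  have hdist : ∀ M > 0, ∃ R > 0, ∀ k, ∀ a ∈ Icc 0 t, ∀ b ∈ Icc 0 t,
      dist (y k a) (y k b) ≤ R * dist a b + C / M := by
    intro M hM
    obtain ⟨R, hR, hsum⟩ := hsum M hM
    refine ⟨R, hR, fun k a ha b hb => ?_⟩
    have := hsum k (1, fun _ => (a, b))
      ⟨fun _ _ => by rw [uIcc_of_le ht]; exact ⟨ha, hb⟩, by simp [PairwiseDisjoint]⟩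
    simpa using this
  have hequi : ∀ ε > 0, ∃ δ > 0, ∀ k, ∀ a ∈ Icc 0 t, ∀ b ∈ Icc 0 t, dist a b < δ →
      dist (y k a) (y k b) < ε := by
    intro ε hε
    obtain ⟨R, hR, hdist⟩ := hdist (2 * (C + 1) / ε) (by positivity)
    refine ⟨ε / 2 / R, by positivity, fun k a ha b hb hab => (hdist k a ha b hb).trans_lt ?_⟩
    have h1 : R * dist a b < ε / 2 := by rwa [lt_div_iff₀' hR] at hab
    have h2 : C / (2 * (C + 1) / ε) ≤ ε / 2 := by
      rw [div_div_eq_mul_div, div_le_div_iff₀ (by positivity) two_pos]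
      nlinarith
    linarith
  have hy0 : ∀ k, y k 0 = x := fun k => by simp [(harc k).eq_add_integral 0 h0]
  have hYlim : ∀ s, ∃ z, s ∈ Icc 0 t → Tendsto (fun k => y k s) f (𝓝 z) := by
    intro s
    by_cases hs : s ∈ Icc 0 t
    · obtain ⟨R, hR, hdist⟩ := hdist 1 one_pos
      obtain ⟨z, -, hz⟩ := (isCompact_closedBall x (R * dist s 0 + C / 1)).ultrafilter_le_nhds'
        (f.map fun k => y k s) (Ultrafilter.mem_map.2 <| univ_mem' fun k => by
          simpa [hy0] using hdist k s hs 0 h0)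
      exact ⟨z, fun _ => hz⟩
    · exact ⟨0, fun h => absurd h hs⟩
  choose Y hY using hYlim
  have hAmono : ∀ k, ∀ a ∈ Icc 0 t, ∀ b ∈ Icc 0 t, a ≤ b →
      ∫ s in (0 : ℝ)..a, Lk k (y k s) (y' k s) ≤ ∫ s in (0 : ℝ)..b, Lk k (y k s) (y' k s) := by
    intro k a ha b hb hab
    rw [← sub_nonneg, intervalIntegral.integral_interval_sub_left
      ((hℓ k).mono_mem_Icc h0 hb) ((hℓ k).mono_mem_Icc h0 ha)]
    exact intervalIntegral.integral_nonneg hab fun s _ => hLk0 k _ _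
  have hAlim : ∀ s, ∃ z, s ∈ Icc 0 t →
      Tendsto (fun k => ∫ r in (0 : ℝ)..s, Lk k (y k r) (y' k r)) f (𝓝 z) := by
    intro s
    by_cases hs : s ∈ Icc 0 t
    · obtain ⟨z, -, hz⟩ := (isCompact_Icc (a := 0) (b := C)).ultrafilter_le_nhds'
        (f.map fun k => ∫ r in (0 : ℝ)..s, Lk k (y k r) (y' k r))
        (Ultrafilter.mem_map.2 <| univ_mem' fun k =>
          ⟨intervalIntegral.integral_nonneg hs.1 fun s _ => hLk0 k _ _,
            (hAmono k s hs t htI hs.2).trans (hC k)⟩)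
      exact ⟨z, fun _ => hz⟩
    · exact ⟨0, fun h => absurd h hs⟩
  choose A hA using hAlim
  have hAmonoOn : MonotoneOn A (uIcc 0 t) := by
    rw [uIcc_of_le ht]
    exact fun a ha b hb hab => le_of_tendsto_of_tendsto (hA a ha) (hA b hb)
      (Eventually.of_forall fun k => hAmono k a ha b hb hab)
  have hA0 : A 0 = 0 := tendsto_nhds_unique (hA 0 h0) (by simp)
  have hY0 : Y 0 = x := tendsto_nhds_unique (hY 0 h0) (by simp [hy0])
  have hYac : AbsolutelyContinuousOnInterval Y 0 t := by
    rw [absolutelyContinuousOnInterval_iff]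
    intro ε hε
    obtain ⟨R, hR, hsum⟩ := hsum (2 * (C + 1) / ε) (by positivity)
    refine ⟨ε / 2 / R, by positivity, fun I hI hlt => ?_⟩
    have hle : ∑ i ∈ Finset.range I.1, dist (Y (I.2 i).1) (Y (I.2 i).2) ≤
        R * (∑ i ∈ Finset.range I.1, dist (I.2 i).1 (I.2 i).2) + C / (2 * (C + 1) / ε) := by
      refine le_of_tendsto (x := (f : Filter ℕ)) (tendsto_finsetSum _ fun i hi => ?_)
        (Eventually.of_forall fun k => hsum k I hI)
      have := hI.1 i hi
      rw [uIcc_of_le ht] at this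
      exact (hY _ this.1).dist (hY _ this.2)
    have h1 : R * (∑ i ∈ Finset.range I.1, dist (I.2 i).1 (I.2 i).2) < ε / 2 := by
      rwa [lt_div_iff₀' hR] at hlt
    have h2 : C / (2 * (C + 1) / ε) ≤ ε / 2 := by
      rw [div_div_eq_mul_div, div_le_div_iff₀ (by positivity) two_pos]
      nlinarith
    linarith
  obtain ⟨Y', hYarc, hYderiv⟩ := hYac.exists_isArc ht
  have hle : ∀ᵐ s, s ∈ uIoc 0 t → L (Y s) (Y' s) ≤ deriv A s := by
    have hne : ∀ᵐ s : ℝ, s ≠ t := by simp [ae_iff, measure_singleton]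
    filter_upwards [hYderiv, hAmonoOn.ae_differentiableWithinAt_of_mem, hne] with s hsY hsA hst hs
    rw [uIoc_of_le ht] at hs
    have hsI : s ∈ Icc 0 t := Ioc_subset_Icc_self hs
    have hsO : s ∈ Ioo 0 t := ⟨hs.1, lt_of_le_of_ne hs.2 hst⟩
    have hsd : DifferentiableAt ℝ A s := (hsA (by rwa [uIcc_of_le ht])).differentiableAt
      (by rw [uIcc_of_le ht]; exact Icc_mem_nhds hsO.1 hsO.2)
    refine IsArc.le_hasDerivAt_cost_of_tendsto harc hℓ hequi hY hA hsO (hsY hsI) hsd.hasDerivAt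
      fun ε hε => ?_
    exact (exists_affine_minorant_eventually hLlsc hLconv hLklsc hΘ hcoer hmono hlim (Y s) (Y' s)
      hε).imp fun l hl => hl.filter_mono (prod_mono_left _ hf)
  have hmeas : AEStronglyMeasurable (fun s => L (Y s) (Y' s)) (volume.restrict (uIoc 0 t)) := by
    have hYc : AEMeasurable Y (volume.restrict (uIoc 0 t)) := by
      rw [uIoc_of_le ht]
      exact ((hYarc.continuousOn ht).mono Ioc_subset_Icc_self).aemeasurable measurableSet_Ioc
    exact (hLlsc.measurable.comp_aemeasurable
      (hYc.prodMk hYarc.intervalIntegrable.def'.aemeasurable)).aestronglyMeasurable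
  have hint : IntervalIntegrable (fun s => L (Y s) (Y' s)) volume 0 t := by
    refine (hAmonoOn.intervalIntegrable_deriv).mono_fun hmeas ?_
    refine (ae_restrict_iff' measurableSet_uIoc).2 (hle.mono fun s hs hmem => ?_)
    dsimp only
    rw [Real.norm_of_nonneg (hL0 _ _)]
    exact (hs hmem).trans (le_abs_self _)
  refine ⟨Y, Y', hY0 ▸ hYarc, hint, hY t htI, A t, hA t htI, ?_⟩
  calc ∫ s in (0 : ℝ)..t, L (Y s) (Y' s) ≤ ∫ s in (0 : ℝ)..t, deriv A s := by
        rw [intervalIntegral.integral_of_le ht, intervalIntegral.integral_of_le ht]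
        exact setIntegral_mono_on_ae hint.1 hAmonoOn.intervalIntegrable_deriv.1 measurableSet_Ioc
          (uIoc_of_le ht ▸ hle)
    _ ≤ A t := by
        have hmem := hAmonoOn.intervalIntegral_deriv_mem_uIcc
        rw [hA0, sub_zero, uIcc_of_le] at hmem
        · exact hmem.2
        · exact hA0 ▸ hAmonoOn left_mem_uIcc right_mem_uIcc ht

theorem IsArc.bolzaValue_le {n : ℕ}
    {L : EuclideanSpace ℝ (Fin n) → EuclideanSpace ℝ (Fin n) → ℝ}
    {x : EuclideanSpace ℝ (Fin n)} {t : ℝ} {y y' : ℝ → EuclideanSpace ℝ (Fin n)}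
    (h : IsArc x t y y') (hL : IntervalIntegrable (fun s => L (y s) (y' s)) volume 0 t)
    (φ : EuclideanSpace ℝ (Fin n) → ℝ≥0∞) :
    bolzaValue L φ t x ≤ ENNReal.ofReal (∫ s in (0 : ℝ)..t, L (y s) (y' s)) + φ (y t) :=
  iInf₂_le_of_le y y' <| iInf₂_le_of_le h.intervalIntegrable h.eq_add_integral <|
    iInf_le_of_le hL le_rfl

theorem bolzaValue_mono {n : ℕ} {L₁ L₂ : EuclideanSpace ℝ (Fin n) → EuclideanSpace ℝ (Fin n) → ℝ}
    (hcont : Continuous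
      (fun p : EuclideanSpace ℝ (Fin n) × EuclideanSpace ℝ (Fin n) => L₁ p.1 p.2))
    (h0 : ∀ x u, 0 ≤ L₁ x u) (hle : ∀ x u, L₁ x u ≤ L₂ x u)
    (φ : EuclideanSpace ℝ (Fin n) → ℝ≥0∞) {t : ℝ} (ht : 0 ≤ t) (x : EuclideanSpace ℝ (Fin n)) :
    bolzaValue L₁ φ t x ≤ bolzaValue L₂ φ t x := by
  refine le_iInf fun y => le_iInf fun y' => le_iInf fun hy' => le_iInf fun hy => le_iInf fun hL => ?_
  have hyc : AEMeasurable y (volume.restrict (uIoc 0 t)) := by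
    rw [uIoc_of_le ht]
    exact ((IsArc.continuousOn ⟨hy', hy⟩ ht).mono Ioc_subset_Icc_self).aemeasurable
      measurableSet_Ioc
  have hint : IntervalIntegrable (fun s => L₁ (y s) (y' s)) volume 0 t := by
    refine hL.mono_fun (hcont.measurable.comp_aemeasurable
      (hyc.prodMk hy'.def'.aemeasurable)).aestronglyMeasurable (Eventually.of_forall fun s => ?_)
    simp only [Real.norm_eq_abs]
    exact abs_le_abs_of_nonneg (h0 _ _) (hle _ _)
  refine (IsArc.bolzaValue_le ⟨hy', hy⟩ hint φ).trans ?_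
  gcongr
  exact intervalIntegral.integral_mono_on ht hint hL fun s _ => hle _ _

theorem stmt_16 {n : ℕ}
    (L : EuclideanSpace ℝ (Fin n) → EuclideanSpace ℝ (Fin n) → ℝ)
    (Lk : ℕ → EuclideanSpace ℝ (Fin n) → EuclideanSpace ℝ (Fin n) → ℝ)
    (hL0 : ∀ x u, 0 ≤ L x u) (hLk0 : ∀ k x u, 0 ≤ Lk k x u)
    (hLlsc : LowerSemicontinuous
      (fun p : EuclideanSpace ℝ (Fin n) × EuclideanSpace ℝ (Fin n) => L p.1 p.2))
    (hLconv : ∀ x, ConvexOn ℝ Set.univ (L x))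
    (hLkcont : ∀ k, Continuous
      (fun p : EuclideanSpace ℝ (Fin n) × EuclideanSpace ℝ (Fin n) => Lk k p.1 p.2))
    (hLkconv : ∀ k x, ConvexOn ℝ Set.univ (Lk k x))
    (Θ : EuclideanSpace ℝ (Fin n) → ℝ) (hΘ0 : ∀ u, 0 ≤ Θ u)
    (hΘconv : ConvexOn ℝ Set.univ Θ) (hΘsuper : Superlinear Θ)
    (hcoerck : ∀ k x u, Θ u ≤ Lk k x u) (hcoerc : ∀ x u, Θ u ≤ L x u)
    (hmono : ∀ k x u, Lk k x u ≤ Lk (k + 1) x u)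
    (hle : ∀ k x u, Lk k x u ≤ L x u)
    (hlim : ∀ x u, Tendsto (fun k => Lk k x u) atTop (nhds (L x u)))
    (φ : EuclideanSpace ℝ (Fin n) → ℝ≥0∞)
    (hφlsc : LowerSemicontinuous φ) (hφ : ∃ x, φ x ≠ ⊤) :
    ∀ t : ℝ, 0 ≤ t → ∀ x : EuclideanSpace ℝ (Fin n),
      Tendsto (fun k => bolzaValue (Lk k) φ t x) atTop (nhds (bolzaValue L φ t x)) := by
  intro t ht x
  have hVmono : Monotone fun k => bolzaValue (Lk k) φ t x :=
    monotone_nat_of_le_succ fun k => bolzaValue_mono (hLkcont k) (hLk0 k) (hmono k) φ ht x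
  have hVle : ∀ k, bolzaValue (Lk k) φ t x ≤ bolzaValue L φ t x :=
    fun k => bolzaValue_mono (hLkcont k) (hLk0 k) (hle k) φ ht x
  suffices hsup : bolzaValue L φ t x ≤ ⨆ k, bolzaValue (Lk k) φ t x by
    rw [le_antisymm hsup (iSup_le hVle)]
    exact tendsto_atTop_iSup hVmono
  refine le_of_forall_gt_imp_ge_of_dense fun c hc => ?_
  by_cases hctop : c = ⊤
  · exact hctop ▸ le_top
  have hex : ∀ k, ∃ y y', IsArc x t y y' ∧
      IntervalIntegrable (fun s => Lk k (y s) (y' s)) volume 0 t ∧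
      ENNReal.ofReal (∫ s in (0 : ℝ)..t, Lk k (y s) (y' s)) + φ (y t) < c := by
    intro k
    have hk : bolzaValue (Lk k) φ t x < c := (le_iSup _ k).trans_lt hc
    simp only [bolzaValue, iInf_lt_iff] at hk
    obtain ⟨y, y', hy', hy, hℓ, hlt⟩ := hk
    exact ⟨y, y', ⟨hy', hy⟩, hℓ, hlt⟩
  choose y y' harc hℓ hlt using hex
  obtain ⟨Y, Y', hY, hint, hYt, a, ha, hcost⟩ := exists_isArc_cost_le_of_ultrafilter hL0 hLlsc
    hLconv (fun k => (hLkcont k).lowerSemicontinuous) hΘ0 hΘsuper hcoerck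
    (fun x u => monotone_nat_of_le_succ fun k => hmono k x u) hlim ht harc hℓ (C := c.toReal)
    (fun k => (ENNReal.ofReal_le_iff_le_toReal hctop).1 (le_self_add.trans (hlt k).le))
    (hyperfilter ℕ) Nat.hyperfilter_le_atTop
  refine (hY.bolzaValue_le hint φ).trans ?_
  have hterm : ∀ r < φ (Y t), ENNReal.ofReal a + r ≤ c := fun r hr =>
    le_of_tendsto ((ENNReal.tendsto_ofReal ha).add_const r) <| by
      filter_upwards [hYt.eventually (hφlsc (Y t) r hr)] with k hk
      exact (add_le_add_right hk.le _).trans (hlt k).le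
  have hac : ENNReal.ofReal a ≤ c :=
    le_of_tendsto (ENNReal.tendsto_ofReal ha)
      (Eventually.of_forall fun k => le_self_add.trans (hlt k).le)
  calc ENNReal.ofReal (∫ s in (0 : ℝ)..t, L (Y s) (Y' s)) + φ (Y t)
      ≤ ENNReal.ofReal a + (c - ENNReal.ofReal a) :=
        add_le_add (ENNReal.ofReal_le_ofReal hcost) <| le_of_forall_lt_imp_le_of_dense fun r hr =>
          ENNReal.le_sub_of_add_le_left ENNReal.ofReal_ne_top (hterm r hr)
    _ = c := add_tsub_cancel_of_le hac
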